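/- Let F be a field. There exists an F-linear bijection φ from the coinvariant algebra F[x_1,…,x_n]/(F[x]^{𝔖_n}_+) onto the F-vector space with basis {e_w : w ∈ 𝔖_n} such that φ(π̄_i(v)) = L_i(φ(v)) for all v and all 1 ≤ i ≤ n−1, where L_i(e_w) = e_{s_i w} if ℓ(s_i w) > ℓ(w) and L_i(e_w) = −e_w if ℓ(s_i w) < ℓ(w). In other words, the coinvariant algebra, with the operators π̄_i, is isomorphic to the left regular representation of the 0-Hecke algebra H_n(0) in its standard basis {T_w : w ∈ 𝔖_n}. (Theorem 1.2.) -/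

import Mathlib

open MvPolynomial

/-- Value of a permutation of `Fin n` as a function `ℕ → ℕ` (0 outside range). -/
def pval {n : ℕ} (w : Equiv.Perm (Fin n)) (i : ℕ) : ℕ :=
  if h : i < n then (w ⟨i, h⟩ : ℕ) else 0

/-- 0-based descent set of `w`: `i ∈ permDes w` iff `w(i) > w(i+1)`, `0 ≤ i ≤ n-2`.
(This corresponds to the 1-based descent `i+1` of the paper.) -/
def permDes {n : ℕ} (w : Equiv.Perm (Fin n)) : Finset ℕ :=
  (Finset.range (n - 1)).filter fun i => pval w (i + 1) < pval w i

/-- Number of inversions = Coxeter length of `w`. -/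
def invNum {n : ℕ} (w : Equiv.Perm (Fin n)) : ℕ :=
  (Finset.univ.filter fun p : Fin n × Fin n => p.1 < p.2 ∧ w p.2 < w p.1).card

/-- The simple transposition `s_i = (i, i+1)` (0-based); identity if out of range. -/
def sw (n : ℕ) (i : ℕ) : Equiv.Perm (Fin n) :=
  if h : i + 1 < n then Equiv.swap ⟨i, Nat.lt_of_succ_lt h⟩ ⟨i + 1, h⟩ else 1

/-- Exponent vector of `x_I = ∏_{i ∈ I} (x_0 x_1 ⋯ x_i)`. -/
def expI (n : ℕ) (I : Finset ℕ) : Fin n → ℕ := fun j => (I.filter fun i => (j : ℕ) ≤ i).card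

/-- The monomial `x_I = ∏_{i ∈ I} (x_0 x_1 ⋯ x_i)`. -/
noncomputable def xI (R : Type*) [CommRing R] (n : ℕ) (I : Finset ℕ) :
    MvPolynomial (Fin n) R :=
  ∏ j : Fin n, (X j) ^ expI n I j

/-- `λ(d)`: the decreasing rearrangement of an exponent vector. -/
def lam {n : ℕ} (d : Fin n → ℕ) : List ℕ := (List.ofFn d).insertionSort (· ≥ ·)

/-- `x^d ≺ x^e` : `λ(d)` lexicographically smaller than `λ(e)`. -/
def monLT {n : ℕ} (d e : Fin n → ℕ) : Prop := List.Lex (· < ·) (lam d) (lam e)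

/-- 0-based descent set `D(α)` of a composition `α` of `n`:
`{α_1 + ⋯ + α_j - 1 : 1 ≤ j ≤ ℓ(α) - 1}` (0-based shift of the paper's `D(α)`). -/
def compDes {n : ℕ} (c : Composition n) : Finset ℕ :=
  (Finset.range (c.length - 1)).image fun j => c.sizeUpTo (j + 1) - 1

/-- The ideal of `F[x]` generated by the symmetric (`𝔖_n`-invariant) polynomials with zero
constant term; the coinvariant algebra is the quotient by this ideal. -/
noncomputable def coinvIdeal (n : ℕ) (F : Type*) [Field F] : Ideal (MvPolynomial (Fin n) F) :=
  Ideal.span {f : MvPolynomial (Fin n) F | f.IsSymmetric ∧ constantCoeff f = 0}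

/-- Left multiplication by the generator `T_i` of the 0-Hecke algebra `H_n(0)` on its
standard basis `{T_w : w ∈ 𝔖_n}` (realized on the free `F`-module on `𝔖_n`):
`T_i ⬝ T_w = T_{s_i w}` if `ℓ(s_i w) > ℓ(w)`, and `T_i ⬝ T_w = -T_w` otherwise. -/
noncomputable def Lop (F : Type*) [Field F] (n i : ℕ) :
    (Equiv.Perm (Fin n) →₀ F) →ₗ[F] (Equiv.Perm (Fin n) →₀ F) :=
  Finsupp.lsum F fun w => LinearMap.toSpanSingleton F _
    (if invNum w < invNum (sw n i * w) then Finsupp.single (sw n i * w) (1 : F)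
     else -Finsupp.single w (1 : F))

section Permutations

variable {n : ℕ}

/-- `i` is a left ascent of `w`: the value `i` occurs before the value `i + 1`. -/
def LeftAscent (w : Equiv.Perm (Fin n)) (i : ℕ) : Prop :=
  ∃ h : i + 1 < n, w⁻¹ ⟨i, Nat.lt_of_succ_lt h⟩ < w⁻¹ ⟨i + 1, h⟩

/-- `i` is a left descent of `w`: the value `i + 1` occurs before the value `i`. -/
def LeftDescent (w : Equiv.Perm (Fin n)) (i : ℕ) : Prop :=
  ∃ h : i + 1 < n, w⁻¹ ⟨i + 1, h⟩ < w⁻¹ ⟨i, Nat.lt_of_succ_lt h⟩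

theorem sw_of_lt {i : ℕ} (h : i + 1 < n) :
    sw n i = Equiv.swap ⟨i, Nat.lt_of_succ_lt h⟩ ⟨i + 1, h⟩ := dif_pos h

theorem sw_inv (i : ℕ) : (sw n i)⁻¹ = sw n i := by
  unfold sw
  split_ifs
  · exact Equiv.swap_inv _ _
  · exact inv_one

theorem sw_mul_self (i : ℕ) : sw n i * sw n i = 1 := by
  rw [← inv_mul_cancel (sw n i), sw_inv]

theorem sw_mul_cancel (i : ℕ) (w : Equiv.Perm (Fin n)) : sw n i * (sw n i * w) = w := by
  rw [← mul_assoc, sw_mul_self, one_mul]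

theorem coe_sw_apply {i : ℕ} (h : i + 1 < n) (u : Fin n) :
    ((sw n i u : Fin n) : ℕ) = if (u : ℕ) = i then i + 1 else if (u : ℕ) = i + 1 then i else u := by
  rw [sw_of_lt h, Equiv.swap_apply_def]
  simp only [Fin.ext_iff]
  split_ifs <;> rfl

theorem sw_apply_left {i : ℕ} (h : i + 1 < n) :
    sw n i ⟨i, Nat.lt_of_succ_lt h⟩ = ⟨i + 1, h⟩ := by
  rw [sw_of_lt h, Equiv.swap_apply_left]

theorem sw_apply_right {i : ℕ} (h : i + 1 < n) :
    sw n i ⟨i + 1, h⟩ = ⟨i, Nat.lt_of_succ_lt h⟩ := by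
  rw [sw_of_lt h, Equiv.swap_apply_right]

theorem sw_apply_of_ne {i : ℕ} {u : Fin n} (h₁ : (u : ℕ) ≠ i) (h₂ : (u : ℕ) ≠ i + 1) :
    sw n i u = u := by
  by_cases h : i + 1 < n
  · rw [Fin.ext_iff, coe_sw_apply h, if_neg h₁, if_neg h₂]
  · simp [sw, h]

theorem sw_braid {i : ℕ} (h : i + 2 < n) :
    sw n i * sw n (i + 1) * sw n i = sw n (i + 1) * sw n i * sw n (i + 1) := by
  ext u
  simp only [Equiv.Perm.mul_apply, coe_sw_apply (show i + 1 < n by omega),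
    coe_sw_apply (show i + 1 + 1 < n by omega)]
  split_ifs <;> omega

theorem sw_comm {i j : ℕ} (hi : i + 1 < n) (hj : j + 1 < n) (hij : i + 1 < j) :
    sw n i * sw n j = sw n j * sw n i := by
  ext u
  simp only [Equiv.Perm.mul_apply, coe_sw_apply hi, coe_sw_apply hj]
  split_ifs <;> omega

theorem leftDescent_sw_mul {w : Equiv.Perm (Fin n)} {i : ℕ} :
    LeftDescent (sw n i * w) i ↔ LeftAscent w i := by
  refine exists_congr fun h => ?_
  rw [mul_inv_rev, sw_inv, Equiv.Perm.mul_apply, Equiv.Perm.mul_apply, sw_apply_left h,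
    sw_apply_right h]

theorem leftAscent_sw_mul {w : Equiv.Perm (Fin n)} {i : ℕ} :
    LeftAscent (sw n i * w) i ↔ LeftDescent w i := by
  rw [← leftDescent_sw_mul, sw_mul_cancel]

theorem leftAscent_or_leftDescent (w : Equiv.Perm (Fin n)) {i : ℕ} (h : i + 1 < n) :
    LeftAscent w i ∨ LeftDescent w i := by
  rcases lt_trichotomy (w⁻¹ ⟨i, Nat.lt_of_succ_lt h⟩) (w⁻¹ ⟨i + 1, h⟩) with h' | h' | h'
  · exact Or.inl ⟨h, h'⟩
  · simp at h'
  · exact Or.inr ⟨h, h'⟩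

theorem invNum_sw_mul {w : Equiv.Perm (Fin n)} {i : ℕ} (hw : LeftAscent w i) :
    invNum (sw n i * w) = invNum w + 1 := by
  obtain ⟨h, hlt⟩ := hw
  set a : Fin n := ⟨i, Nat.lt_of_succ_lt h⟩ with ha
  set b : Fin n := ⟨i + 1, h⟩ with hb
  unfold invNum
  rw [← Finset.card_insert_of_notMem (a := (w⁻¹ a, w⁻¹ b))]
  · congr 1
    ext ⟨x, y⟩
    obtain ⟨u, rfl⟩ := w⁻¹.surjective x
    obtain ⟨v, rfl⟩ := w⁻¹.surjective y
    rw [Finset.mem_filter, Finset.mem_insert, Finset.mem_filter]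
    simp only [Finset.mem_univ, true_and, Prod.mk.injEq,
      EmbeddingLike.apply_eq_iff_eq, Equiv.Perm.mul_apply, show ∀ x, w (w⁻¹ x) = x from w.apply_symm_apply]
    rw [Fin.lt_def (a := sw n i v), Fin.lt_def (a := v), coe_sw_apply h, coe_sw_apply h]
    by_cases hu : u = a ∧ v = b
    · obtain ⟨rfl, rfl⟩ := hu
      simpa [a, b] using hlt
    by_cases hv : u = b ∧ v = a
    · obtain ⟨rfl, rfl⟩ := hv
      simp only [hlt.not_gt, false_and, or_false]
      simp [a, b]
    · simp only [Fin.ext_iff, ha, hb] at hu hv ⊢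
      split_ifs <;> constructor <;> intro H <;> omega
  · simp [a, b]

theorem invNum_inv (w : Equiv.Perm (Fin n)) : invNum w⁻¹ = invNum w := by
  unfold invNum
  refine Finset.card_bij (fun p _ => (w⁻¹ p.2, w⁻¹ p.1)) ?_ ?_ ?_
  · rintro ⟨x, y⟩ hp
    simpa [and_comm] using hp
  · rintro ⟨x, y⟩ _ ⟨x', y'⟩ _ h
    simpa [and_comm] using h
  · rintro ⟨x, y⟩ hp
    exact ⟨(w y, w x), by simpa [and_comm] using hp, by simp⟩

theorem invNum_mul_sw {w : Equiv.Perm (Fin n)} {i : ℕ} (hw : LeftAscent w⁻¹ i) :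
    invNum (w * sw n i) = invNum w + 1 := by
  rw [← invNum_inv, mul_inv_rev, sw_inv, invNum_sw_mul hw, invNum_inv]

theorem invNum_sw_mul_of_leftDescent {w : Equiv.Perm (Fin n)} {i : ℕ} (hw : LeftDescent w i) :
    invNum (sw n i * w) + 1 = invNum w := by
  rw [← invNum_sw_mul (leftAscent_sw_mul.2 hw), sw_mul_cancel]

theorem eq_one_of_strictMono {w : Equiv.Perm (Fin n)} (h : StrictMono w) : w = 1 := by
  have := Subsingleton.elim (h.orderIsoOfSurjective _ w.surjective) (OrderIso.refl (Fin n))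
  ext x
  simpa using congrArg (fun e : Fin n ≃o Fin n => ((e x : Fin n) : ℕ)) this

theorem fin_strictMono_of_lt_succ {α : Type*} [Preorder α] {f : Fin n → α}
    (h : ∀ (i : ℕ) (hi : i + 1 < n), f ⟨i, Nat.lt_of_succ_lt hi⟩ < f ⟨i + 1, hi⟩) :
    StrictMono f := by
  cases n with
  | zero => exact fun x => x.elim0
  | succ n => exact Fin.strictMono_iff_lt_succ.2 fun i => h i (by omega)

theorem exists_leftDescent {w : Equiv.Perm (Fin n)} (hw : w ≠ 1) : ∃ i, LeftDescent w i := by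
  by_contra! H
  refine hw (inv_eq_one.1 (eq_one_of_strictMono (fin_strictMono_of_lt_succ fun i hi => ?_)))
  obtain ⟨_, h⟩ := (leftAscent_or_leftDescent w hi).resolve_right (H i)
  exact h

/-- Every permutation is built from the identity by left multiplications that increase length. -/
theorem perm_induction {P : Equiv.Perm (Fin n) → Prop} (one : P 1)
    (step : ∀ i w, LeftAscent w i → P w → P (sw n i * w)) (w : Equiv.Perm (Fin n)) : P w := by
  induction hN : invNum w using Nat.strong_induction_on generalizing w with
  | _ N ih =>
    subst hN
    by_cases hw : w = 1
    · exact hw ▸ one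
    · obtain ⟨i, hi⟩ := exists_leftDescent hw
      have hlen := invNum_sw_mul_of_leftDescent hi
      rw [← sw_mul_cancel i w]
      exact step i _ (leftAscent_sw_mul.2 hi) (ih _ (by omega) _ rfl)

open Classical in
/-- The product `A i₁ * ⋯ * A iₖ` along a reduced word `s i₁ ⋯ s iₖ` of `w`. -/
noncomputable def heckeLift {E : Type*} [Monoid E] (A : ℕ → E) (w : Equiv.Perm (Fin n)) : E :=
  if h : ∃ i, LeftDescent w i then A h.choose * heckeLift A (sw n h.choose * w) else 1
termination_by invNum w
decreasing_by
  have := invNum_sw_mul_of_leftDescent h.choose_spec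
  omega

section HeckeLift

variable {E : Type*} [Monoid E] {A : ℕ → E}

theorem heckeLift_one : heckeLift A (1 : Equiv.Perm (Fin n)) = 1 := by
  rw [heckeLift, dif_neg]
  rintro ⟨i, h, hlt⟩
  simp [Fin.lt_def] at hlt

/-- Matsumoto's property: `heckeLift` does not depend on the reduced word. -/
theorem heckeLift_of_leftDescent
    (hcomm : ∀ i j, i + 1 < j → j + 1 < n → A i * A j = A j * A i)
    (hbraid : ∀ i, i + 2 < n → A i * A (i + 1) * A i = A (i + 1) * A i * A (i + 1))
    {w : Equiv.Perm (Fin n)} {i : ℕ} (hi : LeftDescent w i) :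
    heckeLift A w = A i * heckeLift A (sw n i * w) := by
  induction hN : invNum w using Nat.strong_induction_on generalizing w i with
  | _ N ih =>
    subst hN
    have key : ∀ i j, i < j → LeftDescent w i → LeftDescent w j →
        A i * heckeLift A (sw n i * w) = A j * heckeLift A (sw n j * w) := by
      intro i j hij hi hj
      have li := invNum_sw_mul_of_leftDescent hi
      have lj := invNum_sw_mul_of_leftDescent hj
      obtain ⟨hi', hi⟩ := hi
      obtain ⟨hj', hj⟩ := hj
      rcases Nat.lt_or_ge (i + 1) j with hlt | hge
      · have d₁ : LeftDescent (sw n i * w) j := ⟨hj', by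
          simpa [mul_inv_rev, sw_inv, sw_apply_of_ne, show j ≠ i by omega,
            show j ≠ i + 1 by omega, show j + 1 ≠ i by omega] using hj⟩
        have d₂ : LeftDescent (sw n j * w) i := ⟨hi', by
          simpa [mul_inv_rev, sw_inv, sw_apply_of_ne, show i ≠ j by omega,
            show i ≠ j + 1 by omega, show i + 1 ≠ j by omega] using hi⟩
        rw [ih _ (by omega) d₁ rfl, ih _ (by omega) d₂ rfl, ← mul_assoc, ← mul_assoc,
          hcomm i j hlt hj', ← mul_assoc, ← mul_assoc, sw_comm hi' hj' hlt]
      · obtain rfl : j = i + 1 := by omega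
        have h₁ : sw n i ⟨i + 1 + 1, hj'⟩ = ⟨i + 1 + 1, hj'⟩ :=
          sw_apply_of_ne (by simp; omega) (by simp)
        have h₂ : sw n (i + 1) ⟨i, by omega⟩ = ⟨i, by omega⟩ :=
          sw_apply_of_ne (by simp) (by simp; omega)
        have d₁ : LeftDescent (sw n i * w) (i + 1) := ⟨hj', by
          simpa [mul_inv_rev, sw_inv, h₁, sw_apply_right hi'] using hj.trans hi⟩
        have d₂ : LeftDescent (sw n (i + 1) * w) i := ⟨hi', by
          simpa [mul_inv_rev, sw_inv, h₂, sw_apply_left hj'] using hj.trans hi⟩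
        have l₁ := invNum_sw_mul_of_leftDescent d₁
        have l₂ := invNum_sw_mul_of_leftDescent d₂
        have d₃ : LeftDescent (sw n (i + 1) * (sw n i * w)) i := ⟨hi', by
          simpa [mul_inv_rev, sw_inv, h₁, h₂, sw_apply_left hi', sw_apply_left hj'] using hj⟩
        have d₄ : LeftDescent (sw n i * (sw n (i + 1) * w)) (i + 1) := ⟨hj', by
          simpa [mul_inv_rev, sw_inv, h₁, h₂, sw_apply_right hi', sw_apply_right hj'] using hi⟩
        rw [ih _ (by omega) d₁ rfl, ih _ (by omega) d₂ rfl, ih _ (by omega) d₃ rfl,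
          ih _ (by omega) d₄ rfl]
        simp only [← mul_assoc]
        rw [hbraid i (by omega), sw_braid (by omega)]
    have hex : ∃ i, LeftDescent w i := ⟨i, hi⟩
    rw [heckeLift, dif_pos hex]
    rcases lt_trichotomy i hex.choose with h | h | h
    · exact (key _ _ h hi hex.choose_spec).symm
    · rw [← h]
    · exact key _ _ h hex.choose_spec hi

theorem heckeLift_sw_mul
    (hcomm : ∀ i j, i + 1 < j → j + 1 < n → A i * A j = A j * A i)
    (hbraid : ∀ i, i + 2 < n → A i * A (i + 1) * A i = A (i + 1) * A i * A (i + 1))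
    {w : Equiv.Perm (Fin n)} {i : ℕ} (hi : LeftAscent w i) :
    heckeLift A (sw n i * w) = A i * heckeLift A w := by
  rw [heckeLift_of_leftDescent hcomm hbraid (leftDescent_sw_mul.2 hi), sw_mul_cancel]

theorem heckeLift_mul_sw
    (hcomm : ∀ i j, i + 1 < j → j + 1 < n → A i * A j = A j * A i)
    (hbraid : ∀ i, i + 2 < n → A i * A (i + 1) * A i = A (i + 1) * A i * A (i + 1))
    {w : Equiv.Perm (Fin n)} {i : ℕ} (hi : LeftAscent w⁻¹ i) :
    heckeLift A (w * sw n i) = heckeLift A w * A i := by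
  induction w using perm_induction with
  | one =>
    have h : LeftAscent (1 : Equiv.Perm (Fin n)) i := by simpa using hi
    rw [one_mul, ← mul_one (sw n i), heckeLift_sw_mul hcomm hbraid h, heckeLift_one, mul_one,
      one_mul]
  | step j u hj ih =>
    have h₀ := invNum_mul_sw hi
    have h₁ := invNum_sw_mul hj
    rw [mul_assoc] at h₀ ⊢
    have hu : LeftAscent u⁻¹ i := by
      refine (leftAscent_or_leftDescent _ hi.1).resolve_right fun hd => ?_
      have h₂ := invNum_sw_mul_of_leftDescent hd
      rw [← invNum_inv, mul_inv_rev, inv_inv, sw_inv, invNum_inv] at h₂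
      rcases leftAscent_or_leftDescent (u * sw n i) hj.1 with h | h
      · have := invNum_sw_mul h
        omega
      · have := invNum_sw_mul_of_leftDescent h
        omega
    have hlen := invNum_mul_sw hu
    have hus : LeftAscent (u * sw n i) j := by
      refine (leftAscent_or_leftDescent _ hj.1).resolve_right fun hd => ?_
      have := invNum_sw_mul_of_leftDescent hd
      omega
    rw [heckeLift_sw_mul hcomm hbraid hus, ih hu, heckeLift_sw_mul hcomm hbraid hj, mul_assoc]

end HeckeLift

end Permutations

section Demazure

/-- The braid relation for the operators `f ↦ b * (f - s f) / (a - b)` and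
`f ↦ c * (f - t f) / (b - c)`, where `s` and `t` exchange `a, b` and `b, c`. -/
theorem demazure_braid {R : Type*} [CommRing R] [IsDomain R] {a b c : R} {s t : R →+* R}
    (sa : s a = b) (sb : s b = a) (sc : s c = c) (ta : t a = a) (tb : t b = c) (tc : t c = b)
    (ss : ∀ f, s (s f) = f) (tt : ∀ f, t (t f) = f) (sts : ∀ f, s (t (s f)) = t (s (t f)))
    (hab : a - b ≠ 0) (hbc : b - c ≠ 0) (hac : a - c ≠ 0) {P Q : R → R}
    (hP : ∀ f, (a - b) * P f = b * (f - s f)) (hQ : ∀ f, (b - c) * Q f = c * (f - t f)) (f : R) :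
    P (Q (P f)) = Q (P (Q f)) := by
  have h₁ : (a - b) * ((a - b) * (b - c) * (a - c) * P (Q (P f))) =
      (a - b) * (b * c ^ 2 * (f - s f - t f + t (s f) + s (t f) - s (t (s f)))) := by
    have e₃ := hP f
    have e₃s := congrArg s e₃
    have e₃t := congrArg t e₃
    have e₃st := congrArg s e₃t
    have e₂ := hQ (P f)
    have e₂s := congrArg s e₂
    have e₁ := hP (Q (P f))
    simp only [map_mul, map_sub, sa, sb, sc, ta, tb, ss] at e₃s e₃t e₃st e₂s
    linear_combination (b - c) * (a - c) * (a - b) * e₁ + b * (a - c) * (a - b) * e₂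
      - b * (b - c) * (a - b) * e₂s + b * c * (a - c) * e₃ - b * c * (a - b) * e₃t
      + b * c * (b - c) * e₃s + b * c * (a - b) * e₃st
  have h₂ : (b - c) * ((a - b) * (b - c) * (a - c) * Q (P (Q f))) =
      (b - c) * (b * c ^ 2 * (f - s f - t f + t (s f) + s (t f) - s (t (s f)))) := by
    have e₃ := hQ f
    have e₃s := congrArg s e₃
    have e₃t := congrArg t e₃
    have e₃ts := congrArg t e₃s
    have e₂ := hP (Q f)
    have e₂t := congrArg t e₂
    have e₁ := hQ (P (Q f))
    rw [sts]
    simp only [map_mul, map_sub, sb, sc, ta, tb, tc, tt] at e₃s e₃t e₃ts e₂t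
    linear_combination (a - b) * (a - c) * (b - c) * e₁ + c * (a - c) * (b - c) * e₂
      - c * (a - b) * (b - c) * e₂t + c * b * (a - c) * e₃ - c * b * (b - c) * e₃s
      + c ^ 2 * (a - b) * e₃t + c ^ 2 * (b - c) * e₃ts
  exact mul_left_cancel₀ (mul_ne_zero (mul_ne_zero hab hbc) hac)
    ((mul_left_cancel₀ hab h₁).trans (mul_left_cancel₀ hbc h₂).symm)

variable {n : ℕ} {F : Type*} [Field F]

/-- `A i` is the operator `π̄ᵢ = πᵢ - 1`, for every simple transposition of `Fin n`. -/
def IsDemazureBar (A : ℕ → Module.End F (MvPolynomial (Fin n) F)) : Prop :=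
  ∀ (i : ℕ) (hi : i + 1 < n) (f : MvPolynomial (Fin n) F),
    (X (⟨i, Nat.lt_of_succ_lt hi⟩ : Fin n) - X ⟨i + 1, hi⟩) * A i f
      = X (⟨i + 1, hi⟩ : Fin n) * (f - rename (sw n i) f)

theorem X_sub_X_ne_zero {a b : Fin n} (h : a ≠ b) : (X a - X b : MvPolynomial (Fin n) F) ≠ 0 :=
  sub_ne_zero.2 fun h' => h (X_injective h')

theorem rename_sw_rename_sw (i : ℕ) (f : MvPolynomial (Fin n) F) :
    rename (sw n i) (rename (sw n i) f) = f := by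
  rw [rename_rename, ← Equiv.Perm.coe_mul, sw_mul_self, Equiv.Perm.coe_one, rename_id_apply]

namespace IsDemazureBar

variable {A : ℕ → Module.End F (MvPolynomial (Fin n) F)}

theorem braid (hA : IsDemazureBar A) (i : ℕ) (hi : i + 2 < n) :
    A i * A (i + 1) * A i = A (i + 1) * A i * A (i + 1) := by
  have h₁ : sw n i ⟨i + 1 + 1, hi⟩ = ⟨i + 1 + 1, hi⟩ := sw_apply_of_ne (by simp; omega) (by simp)
  have h₂ : sw n (i + 1) ⟨i, by omega⟩ = ⟨i, by omega⟩ := sw_apply_of_ne (by simp) (by simp; omega)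
  refine LinearMap.ext fun f => ?_
  refine demazure_braid (s := (rename (sw n i) : _ →ₐ[F] _).toRingHom)
    (t := (rename (sw n (i + 1)) : _ →ₐ[F] _).toRingHom)
    (a := X ⟨i, by omega⟩) (b := X ⟨i + 1, by omega⟩) (c := X ⟨i + 1 + 1, hi⟩)
    ?_ ?_ ?_ ?_ ?_ ?_ (fun f => rename_sw_rename_sw _ f) (fun f => rename_sw_rename_sw _ f)
    (fun f => ?_) (X_sub_X_ne_zero (by simp)) (X_sub_X_ne_zero (by simp))
    (X_sub_X_ne_zero (by simp; omega)) (hA i (by omega)) (hA (i + 1) hi) f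
  · simp [sw_apply_left (show i + 1 < n by omega)]
  · simp [sw_apply_right (show i + 1 < n by omega)]
  · simp [h₁]
  · simp [h₂]
  · simp [sw_apply_left hi]
  · simp [sw_apply_right hi]
  · simp only [AlgHom.toRingHom_eq_coe, RingHom.coe_coe, rename_rename, ← Equiv.Perm.coe_mul,
      ← mul_assoc, sw_braid hi]

theorem map_mul_of_rename_eq (hA : IsDemazureBar A) {i : ℕ} (hi : i + 1 < n)
    {p : MvPolynomial (Fin n) F} (hp : rename (sw n i) p = p) (f : MvPolynomial (Fin n) F) :
    A i (p * f) = p * A i f := by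
  refine mul_left_cancel₀ (X_sub_X_ne_zero
    (show (⟨i, Nat.lt_of_succ_lt hi⟩ : Fin n) ≠ ⟨i + 1, hi⟩ by simp)) ?_
  rw [hA i hi, map_mul, hp, mul_left_comm, hA i hi]
  ring

theorem comm (hA : IsDemazureBar A) (i j : ℕ) (hij : i + 1 < j) (hj : j + 1 < n) :
    A i * A j = A j * A i := by
  have hi : i + 1 < n := by omega
  refine LinearMap.ext fun f => ?_
  have ne₁ := X_sub_X_ne_zero (F := F)
    (show (⟨i, Nat.lt_of_succ_lt hi⟩ : Fin n) ≠ ⟨i + 1, hi⟩ by simp)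
  have ne₂ := X_sub_X_ne_zero (F := F)
    (show (⟨j, Nat.lt_of_succ_lt hj⟩ : Fin n) ≠ ⟨j + 1, hj⟩ by simp)
  have h₁ : sw n i ⟨j, by omega⟩ = ⟨j, by omega⟩ :=
    sw_apply_of_ne (by simp; omega) (by simp; omega)
  have h₂ : sw n i ⟨j + 1, hj⟩ = ⟨j + 1, hj⟩ := sw_apply_of_ne (by simp; omega) (by simp; omega)
  have h₃ : sw n j ⟨i, by omega⟩ = ⟨i, by omega⟩ :=
    sw_apply_of_ne (by simp; omega) (by simp; omega)
  have h₄ : sw n j ⟨i + 1, hi⟩ = ⟨i + 1, hi⟩ := sw_apply_of_ne (by simp; omega) (by simp; omega)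
  have e₁ := hA i hi f
  have e₁' := congrArg (rename (sw n j)) e₁
  have e₂ := hA j hj f
  have e₂' := congrArg (rename (sw n i)) e₂
  have hsw : rename (sw n i) (rename (sw n j) f) = rename (sw n j) (rename (sw n i) f) := by
    rw [rename_rename, rename_rename, ← Equiv.Perm.coe_mul, ← Equiv.Perm.coe_mul,
      sw_comm hi hj hij]
  simp only [map_mul, map_sub, rename_X, h₁, h₂, h₃, h₄] at e₁' e₂'
  rw [hsw] at e₂'
  have e₃ := hA i hi (A j f)
  have e₄ := hA j hj (A i f)
  refine mul_left_cancel₀ (mul_ne_zero ne₁ ne₂) ?_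
  change _ * A i (A j f) = _ * A j (A i f)
  linear_combination (X ⟨j, by omega⟩ - X ⟨j + 1, hj⟩) * e₃ + X ⟨i + 1, hi⟩ * (e₂ - e₂')
    - (X ⟨i, by omega⟩ - X ⟨i + 1, hi⟩) * e₄ - X ⟨j + 1, hj⟩ * (e₁ - e₁')

theorem apply_self (hA : IsDemazureBar A) {i : ℕ} (hi : i + 1 < n) (f : MvPolynomial (Fin n) F) :
    A i (A i f) = -A i f := by
  have ne := X_sub_X_ne_zero (F := F)
    (show (⟨i, Nat.lt_of_succ_lt hi⟩ : Fin n) ≠ ⟨i + 1, hi⟩ by simp)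
  have e₁ := hA i hi f
  have e₁' := congrArg (rename (sw n i)) e₁
  have e₂ := hA i hi (A i f)
  simp only [map_mul, map_sub, rename_X, rename_sw_rename_sw, sw_apply_left hi,
    sw_apply_right hi] at e₁'
  refine mul_left_cancel₀ (mul_ne_zero ne ne) ?_
  linear_combination (X ⟨i, by omega⟩ - X ⟨i + 1, hi⟩) * e₂ + X ⟨i, by omega⟩ * e₁
    + X ⟨i + 1, hi⟩ * e₁'

theorem apply_pow_left (hA : IsDemazureBar A) {i : ℕ} (hi : i + 1 < n) (m : ℕ) :
    A i (X ⟨i, Nat.lt_of_succ_lt hi⟩ ^ m) =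
      ∑ t ∈ Finset.range m, X ⟨i, Nat.lt_of_succ_lt hi⟩ ^ t * X ⟨i + 1, hi⟩ ^ (m - t) := by
  refine mul_left_cancel₀ (X_sub_X_ne_zero
    (show (⟨i, Nat.lt_of_succ_lt hi⟩ : Fin n) ≠ ⟨i + 1, hi⟩ by simp)) ?_
  rw [hA i hi, map_pow, rename_X, sw_apply_left hi, ← geom_sum₂_mul, mul_comm (X _ - X _),
    ← mul_assoc, Finset.mul_sum]
  refine congrArg (· * _) (Finset.sum_congr rfl fun t ht => ?_)
  rw [Finset.mem_range] at ht
  rw [show m - t = m - 1 - t + 1 by omega]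
  ring

theorem apply_pow_right (hA : IsDemazureBar A) {i : ℕ} (hi : i + 1 < n) (m : ℕ) :
    A i (X ⟨i + 1, hi⟩ ^ m) = -A i (X ⟨i, Nat.lt_of_succ_lt hi⟩ ^ m) := by
  refine mul_left_cancel₀ (X_sub_X_ne_zero
    (show (⟨i, Nat.lt_of_succ_lt hi⟩ : Fin n) ≠ ⟨i + 1, hi⟩ by simp)) ?_
  rw [hA i hi, mul_neg, hA i hi, map_pow, map_pow, rename_X, rename_X, sw_apply_left hi,
    sw_apply_right hi]
  ring

end IsDemazureBar

end Demazure

section Monomials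

variable {n : ℕ}

/-- The sum of the squares of the exponents. -/
def sqNorm (d : Fin n →₀ ℕ) : ℕ := ∑ j, d j ^ 2

theorem sqNorm_add_single (d : Fin n →₀ ℕ) (a : Fin n) (m : ℕ) :
    sqNorm (d + Finsupp.single a m) = sqNorm d + 2 * d a * m + m ^ 2 := by
  unfold sqNorm
  rw [← Finset.add_sum_erase _ _ (Finset.mem_univ a), ← Finset.add_sum_erase _ _ (Finset.mem_univ a)]
  have : ∑ x ∈ Finset.univ.erase a, (d + Finsupp.single a m) x ^ 2 =
      ∑ x ∈ Finset.univ.erase a, d x ^ 2 := by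
    refine Finset.sum_congr rfl fun x hx => ?_
    rw [Finsupp.add_apply, Finsupp.single_eq_of_ne (Finset.ne_of_mem_erase hx), add_zero]
  rw [this, Finsupp.add_apply, Finsupp.single_eq_same]
  ring

theorem sqNorm_add_single_add_single {e : Fin n →₀ ℕ} {a b : Fin n} (hab : a ≠ b)
    (he : e a = e b) (t u : ℕ) :
    sqNorm (e + Finsupp.single a t + Finsupp.single b u) =
      sqNorm e + 2 * e a * (t + u) + t ^ 2 + u ^ 2 := by
  rw [sqNorm_add_single, sqNorm_add_single, Finsupp.add_apply,
    Finsupp.single_eq_of_ne hab.symm, he]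
  ring

/-- Every exponent is a part symmetric in `a, b` plus an excess at `a` or at `b`. -/
theorem exists_symmetric_add_single {a b : Fin n} (d : Fin n →₀ ℕ) (h : d b ≤ d a) :
    ∃ e : Fin n →₀ ℕ, e a = e b ∧ d = e + Finsupp.single a (d a - d b) := by
  have hle : Finsupp.single a (d a - d b) ≤ d := by
    rw [Finsupp.single_le_iff]
    omega
  refine ⟨d - Finsupp.single a (d a - d b), ?_, (tsub_add_cancel_of_le hle).symm⟩
  rw [Finsupp.tsub_apply, Finsupp.tsub_apply, Finsupp.single_eq_same]
  by_cases hab : b = a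
  · subst hab
    simp
  · rw [Finsupp.single_eq_of_ne hab]
    omega

/-- The exponent of the monomial obtained by letting `w` permute the variables of `x ^ f`. -/
noncomputable def permExp (w : Equiv.Perm (Fin n)) (f : Fin n → ℕ) : Fin n →₀ ℕ :=
  Finsupp.equivFunOnFinite.symm (f ∘ ⇑w⁻¹)

theorem permExp_apply (w : Equiv.Perm (Fin n)) (f : Fin n → ℕ) (j : Fin n) :
    permExp w f j = f (w⁻¹ j) := rfl

theorem sqNorm_permExp (w : Equiv.Perm (Fin n)) (f : Fin n → ℕ) :
    sqNorm (permExp w f) = ∑ j, f j ^ 2 :=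
  Equiv.sum_comp w⁻¹ fun j => f j ^ 2

theorem degree_permExp (w : Equiv.Perm (Fin n)) (f : Fin n → ℕ) :
    (permExp w f).degree = ∑ j, f j := by
  rw [Finsupp.degree_eq_sum]
  exact Equiv.sum_comp w⁻¹ f

theorem permExp_sw_mul (w : Equiv.Perm (Fin n)) (f : Fin n → ℕ) {i : ℕ} (hi : i + 1 < n)
    {e : Fin n →₀ ℕ} {m : ℕ} (he : e ⟨i, Nat.lt_of_succ_lt hi⟩ = e ⟨i + 1, hi⟩)
    (hd : permExp w f = e + Finsupp.single ⟨i, Nat.lt_of_succ_lt hi⟩ m) :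
    permExp (sw n i * w) f = e + Finsupp.single ⟨i + 1, hi⟩ m := by
  ext j
  have hj := DFunLike.congr_fun hd (sw n i j)
  rw [permExp_apply, Finsupp.add_apply] at hj
  rw [permExp_apply, mul_inv_rev, sw_inv, Equiv.Perm.mul_apply, hj, Finsupp.add_apply]
  by_cases h₁ : (j : ℕ) = i
  · obtain rfl : j = ⟨i, Nat.lt_of_succ_lt hi⟩ := Fin.ext h₁
    simp [sw_apply_left hi, he]
  by_cases h₂ : (j : ℕ) = i + 1
  · obtain rfl : j = ⟨i + 1, hi⟩ := Fin.ext h₂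
    simp [sw_apply_right hi, he]
  · rw [sw_apply_of_ne h₁ h₂, Finsupp.single_eq_of_ne, Finsupp.single_eq_of_ne]
    · rintro rfl
      exact h₂ rfl
    · rintro rfl
      exact h₁ rfl

variable (F : Type*) [Field F]

/-- The span of the monomials of degree `k` whose exponents have sum of squares less than `t`. -/
noncomputable def lowSpan (n k t : ℕ) : Submodule F (MvPolynomial (Fin n) F) :=
  Submodule.span F ((fun d => monomial d (1 : F)) '' {d : Fin n →₀ ℕ | d.degree = k ∧ sqNorm d < t})

variable {F}

theorem monomial_mem_lowSpan {d : Fin n →₀ ℕ} {k t : ℕ} (hk : d.degree = k) (ht : sqNorm d < t) :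
    monomial d (1 : F) ∈ lowSpan F n k t :=
  Submodule.subset_span ⟨d, ⟨hk, ht⟩, rfl⟩

theorem rename_sw_monomial {e : Fin n →₀ ℕ} {i : ℕ} (hi : i + 1 < n)
    (he : e ⟨i, Nat.lt_of_succ_lt hi⟩ = e ⟨i + 1, hi⟩) :
    rename (sw n i) (monomial e (1 : F)) = monomial e 1 := by
  rw [rename_monomial]
  refine congrArg (fun d => monomial d 1) (Finsupp.ext fun j => ?_)
  rw [Finsupp.mapDomain_equiv_apply, ← Equiv.Perm.inv_def, sw_inv]
  by_cases h₁ : (j : ℕ) = i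
  · obtain rfl : j = ⟨i, Nat.lt_of_succ_lt hi⟩ := Fin.ext h₁
    rw [sw_apply_left hi, he]
  by_cases h₂ : (j : ℕ) = i + 1
  · obtain rfl : j = ⟨i + 1, hi⟩ := Fin.ext h₂
    rw [sw_apply_right hi, he]
  · rw [sw_apply_of_ne h₁ h₂]

namespace IsDemazureBar

variable {A : ℕ → Module.End F (MvPolynomial (Fin n) F)}

theorem apply_monomial_left (hA : IsDemazureBar A) {i : ℕ} (hi : i + 1 < n) {e : Fin n →₀ ℕ}
    (he : e ⟨i, Nat.lt_of_succ_lt hi⟩ = e ⟨i + 1, hi⟩) (m : ℕ) :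
    A i (monomial (e + Finsupp.single ⟨i, Nat.lt_of_succ_lt hi⟩ m) 1) =
      ∑ t ∈ Finset.range m, monomial (e + Finsupp.single ⟨i, Nat.lt_of_succ_lt hi⟩ t
        + Finsupp.single ⟨i + 1, hi⟩ (m - t)) 1 := by
  rw [monomial_add_single, hA.map_mul_of_rename_eq hi (rename_sw_monomial hi he),
    hA.apply_pow_left hi, Finset.mul_sum]
  refine Finset.sum_congr rfl fun t _ => ?_
  rw [monomial_add_single, monomial_add_single, mul_assoc]

theorem apply_monomial_right (hA : IsDemazureBar A) {i : ℕ} (hi : i + 1 < n) {e : Fin n →₀ ℕ}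
    (he : e ⟨i, Nat.lt_of_succ_lt hi⟩ = e ⟨i + 1, hi⟩) (m : ℕ) :
    A i (monomial (e + Finsupp.single ⟨i + 1, hi⟩ m) 1) =
      -A i (monomial (e + Finsupp.single ⟨i, Nat.lt_of_succ_lt hi⟩ m) 1) := by
  rw [monomial_add_single, monomial_add_single,
    hA.map_mul_of_rename_eq hi (rename_sw_monomial hi he),
    hA.map_mul_of_rename_eq hi (rename_sw_monomial hi he), hA.apply_pow_right hi, mul_neg]

theorem apply_monomial_sub_mem (hA : IsDemazureBar A) {i : ℕ} (hi : i + 1 < n) {e : Fin n →₀ ℕ}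
    (he : e ⟨i, Nat.lt_of_succ_lt hi⟩ = e ⟨i + 1, hi⟩) {m : ℕ} (hm : 0 < m) :
    A i (monomial (e + Finsupp.single ⟨i, Nat.lt_of_succ_lt hi⟩ m) 1)
        - monomial (e + Finsupp.single ⟨i + 1, hi⟩ m) 1 ∈
      lowSpan F n (e.degree + m) (sqNorm (e + Finsupp.single ⟨i, Nat.lt_of_succ_lt hi⟩ m)) := by
  obtain ⟨m, rfl⟩ : ∃ m', m = m' + 1 := ⟨m - 1, by omega⟩
  rw [hA.apply_monomial_left hi he, Finset.sum_range_succ', Finsupp.single_zero, add_zero,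
    Nat.sub_zero, add_sub_cancel_right]
  refine Submodule.sum_mem _ fun t ht => monomial_mem_lowSpan ?_ ?_
  · rw [Finset.mem_range] at ht
    simp only [map_add, Finsupp.degree_single]
    omega
  · rw [Finset.mem_range] at ht
    rw [sqNorm_add_single_add_single (by simp) he, sqNorm_add_single]
    obtain ⟨u, rfl⟩ : ∃ u, m = t + 1 + u := ⟨m - (t + 1), by omega⟩
    rw [show t + 1 + u + 1 - (t + 1) = u + 1 by omega]
    nlinarith [Nat.zero_le (t * u)]

theorem map_lowSpan_le (hA : IsDemazureBar A) {i : ℕ} (hi : i + 1 < n) (k t : ℕ)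
    {f : MvPolynomial (Fin n) F} (hf : f ∈ lowSpan F n k t) : A i f ∈ lowSpan F n k t := by
  have key : ∀ e : Fin n →₀ ℕ, e ⟨i, Nat.lt_of_succ_lt hi⟩ = e ⟨i + 1, hi⟩ → ∀ m,
      e.degree + m = k → sqNorm e + 2 * e ⟨i, Nat.lt_of_succ_lt hi⟩ * m + m ^ 2 < t →
      A i (monomial (e + Finsupp.single ⟨i, Nat.lt_of_succ_lt hi⟩ m) 1) ∈ lowSpan F n k t := by
    intro e he m hk ht
    rw [hA.apply_monomial_left hi he]
    refine Submodule.sum_mem _ fun r hr => monomial_mem_lowSpan ?_ ?_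
    · rw [Finset.mem_range] at hr
      simp only [map_add, Finsupp.degree_single]
      omega
    · rw [Finset.mem_range] at hr
      rw [sqNorm_add_single_add_single (by simp) he]
      obtain ⟨u, rfl⟩ : ∃ u, m = r + u := ⟨m - r, by omega⟩
      rw [Nat.add_sub_cancel_left]
      nlinarith [Nat.zero_le (r * u)]
  induction hf using Submodule.span_induction with
  | zero => simp
  | add x y _ _ hx hy =>
    rw [map_add]
    exact add_mem hx hy
  | smul c x _ hx =>
    rw [map_smul]
    exact Submodule.smul_mem _ _ hx
  | mem x hx =>
    obtain ⟨d, ⟨hk, ht⟩, rfl⟩ := hx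
    rcases le_total (d ⟨i + 1, hi⟩) (d ⟨i, Nat.lt_of_succ_lt hi⟩) with h | h
    · obtain ⟨e, he, hd⟩ := exists_symmetric_add_single d h
      generalize d ⟨i, Nat.lt_of_succ_lt hi⟩ - d ⟨i + 1, hi⟩ = m at hd
      subst hd
      rw [sqNorm_add_single] at ht
      simp only [map_add, Finsupp.degree_single] at hk
      exact key e he m hk ht
    · obtain ⟨e, he, hd⟩ := exists_symmetric_add_single d h
      generalize d ⟨i + 1, hi⟩ - d ⟨i, Nat.lt_of_succ_lt hi⟩ = m at hd
      subst hd
      rw [sqNorm_add_single, he] at ht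
      simp only [map_add, Finsupp.degree_single] at hk
      change A i (monomial _ 1) ∈ _
      rw [hA.apply_monomial_right hi he.symm]
      exact neg_mem (key e he.symm m hk ht)

theorem heckeLift_mem_lowSpan (hA : IsDemazureBar A) (w : Equiv.Perm (Fin n)) (k t : ℕ)
    {f : MvPolynomial (Fin n) F} (hf : f ∈ lowSpan F n k t) :
    heckeLift A w f ∈ lowSpan F n k t := by
  induction w using perm_induction with
  | one => rwa [heckeLift_one]
  | step i w hi ih =>
    rw [heckeLift_sw_mul hA.comm hA.braid hi]
    exact hA.map_lowSpan_le hi.1 k t ih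

end IsDemazureBar

end Monomials

section LeadingTerms

variable {n : ℕ}

theorem mem_permDes {w : Equiv.Perm (Fin n)} {i : ℕ} : i ∈ permDes w ↔ LeftDescent w⁻¹ i := by
  unfold permDes LeftDescent pval
  rw [Finset.mem_filter, Finset.mem_range, inv_inv]
  constructor
  · rintro ⟨h, hlt⟩
    have hi : i + 1 < n := by omega
    rw [dif_pos hi, dif_pos (show i < n by omega)] at hlt
    exact ⟨hi, hlt⟩
  · rintro ⟨h, hlt⟩
    rw [dif_pos h, dif_pos (show i < n by omega)]
    exact ⟨by omega, hlt⟩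

theorem permDes_subset_sw_mul {w : Equiv.Perm (Fin n)} {i : ℕ} (hi : LeftAscent w i) :
    permDes w ⊆ permDes (sw n i * w) := by
  intro j hj
  rw [mem_permDes] at hj ⊢
  obtain ⟨h, hj⟩ := hj
  obtain ⟨h', hi⟩ := hi
  refine ⟨h, ?_⟩
  rw [inv_inv] at hj ⊢
  have hne : ¬(w ⟨j + 1, h⟩ = ⟨i, by omega⟩ ∧ w ⟨j, by omega⟩ = ⟨i + 1, h'⟩) := by
    rintro ⟨h₁, h₂⟩
    rw [← h₁, ← h₂] at hi
    simp [Fin.lt_def] at hi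
  rw [Equiv.Perm.mul_apply, Equiv.Perm.mul_apply, Fin.lt_def, coe_sw_apply h', coe_sw_apply h']
  rw [Fin.lt_def] at hj
  rw [Fin.ext_iff, Fin.ext_iff] at hne
  dsimp only at hne
  split_ifs <;> omega

theorem lt_of_forall_notMem_permDes {w : Equiv.Perm (Fin n)} {p q : Fin n} (hpq : p < q)
    (h : ∀ r, (p : ℕ) ≤ r → r < q → r ∉ permDes w) : w p < w q := by
  obtain ⟨q, hq⟩ := q
  induction q with
  | zero => exact absurd hpq (by simp [Fin.lt_def])
  | succ q ih =>
    have hlt : w ⟨q, by omega⟩ < w ⟨q + 1, hq⟩ := by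
      have := h q (Nat.lt_succ_iff.1 hpq) (Nat.lt_succ_self q)
      rw [mem_permDes] at this
      obtain ⟨_, h'⟩ := (leftAscent_or_leftDescent _ hq).resolve_right this
      rwa [inv_inv] at h'
    rcases (Nat.lt_succ_iff.1 hpq).eq_or_lt with he | he
    · rwa [show p = ⟨q, by omega⟩ from Fin.ext he]
    · exact (ih (by omega) he fun r h₁ h₂ => h r h₁ (h₂.trans (Nat.lt_succ_self q))).trans hlt

theorem expI_antitone (I : Finset ℕ) : Antitone (expI n I) := fun _ _ hpq =>
  Finset.card_le_card (Finset.monotone_filter_right _ fun _ _ => le_trans (Fin.le_def.1 hpq))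

theorem notMem_of_expI_eq {I : Finset ℕ} {p q : Fin n} (hpq : p ≤ q)
    (h : expI n I p = expI n I q) {r : ℕ} (hp : (p : ℕ) ≤ r) (hq : r < q) : r ∉ I := by
  intro hr
  have := Finset.eq_of_subset_of_card_le
    (Finset.monotone_filter_right I (p := fun i => (q : ℕ) ≤ i) (q := fun i => (p : ℕ) ≤ i)
      fun i _ hi => le_trans (Fin.le_def.1 hpq) hi) h.le
  have hmem : r ∈ I.filter fun i => (p : ℕ) ≤ i := Finset.mem_filter.2 ⟨hr, hp⟩
  rw [← this, Finset.mem_filter] at hmem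
  omega

theorem expI_of_mem {I : Finset ℕ} {i : ℕ} (hi : i + 1 < n) (h : i ∈ I) :
    expI n I ⟨i, Nat.lt_of_succ_lt hi⟩ = expI n I ⟨i + 1, hi⟩ + 1 := by
  unfold expI
  rw [← Finset.card_insert_of_notMem (a := i)]
  · congr 1
    ext j
    simp only [Finset.mem_filter, Finset.mem_insert]
    constructor
    · rintro ⟨h₁, h₂⟩
      rcases h₂.eq_or_lt with h₃ | h₃
      · exact Or.inl h₃.symm
      · exact Or.inr ⟨h₁, h₃⟩
    · rintro (rfl | ⟨h₁, h₂⟩)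
      · exact ⟨h, le_rfl⟩
      · exact ⟨h₁, by omega⟩
  · simp

theorem expI_of_notMem {I : Finset ℕ} {i : ℕ} (hi : i + 1 < n) (h : i ∉ I) :
    expI n I ⟨i, Nat.lt_of_succ_lt hi⟩ = expI n I ⟨i + 1, hi⟩ := by
  unfold expI
  congr 1
  refine Finset.filter_congr fun j hj => ?_
  have : j ≠ i := fun h' => h (h' ▸ hj)
  dsimp only
  omega

theorem xI_eq_monomial (F : Type*) [Field F] (I : Finset ℕ) :
    xI F n I = monomial (permExp 1 (expI n I)) 1 := by
  rw [monomial_eq, C_1, one_mul, Finsupp.prod_fintype _ _ fun _ => pow_zero _]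
  rfl

/-- An exponent in which every positive value `c + 1` occurs after some occurrence of `c` is
obtained by permuting `x_I`, where `I` is the descent set of the permutation. -/
theorem exists_eq_permExp (d : Fin n →₀ ℕ)
    (hd : ∀ c, (∃ j, c + 1 ≤ d j) → ∃ j l, d j = c + 1 ∧ d l = c ∧ l < j) :
    ∃ w : Equiv.Perm (Fin n), d = permExp w (expI n (permDes w)) := by
  obtain ⟨hmono, htie⟩ := Tuple.eq_sort_iff.1 (rfl : Tuple.sort (fun j => OrderDual.toDual (d j)) = _)
  set σ := Tuple.sort (fun j => OrderDual.toDual (d j))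
  replace hmono : ∀ p q, p ≤ q → d (σ q) ≤ d (σ p) := fun p q h => hmono h
  replace htie : ∀ p q, p < q → d (σ p) = d (σ q) → σ p < σ q := fun p q h h' =>
    htie p q h (congrArg OrderDual.toDual h')
  have hlast : ∀ c p, d (σ p) = c + 1 → ∃ q, p < q ∧ d (σ q) = c ∧
      ∀ r, d (σ r) = c + 1 → (∀ s, r < s → d (σ s) ≤ c) → σ q < σ r := by
    intro c p hp
    obtain ⟨j, l, hj, hl, hlj⟩ := hd c ⟨_, hp.ge⟩
    refine ⟨σ⁻¹ l, ?_, ?_, fun r hr hr' => ?_⟩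
    · by_contra! hle
      have := hmono _ _ hle
      rw [show σ (σ⁻¹ l) = l from σ.apply_symm_apply l] at this
      omega
    · rwa [show σ (σ⁻¹ l) = l from σ.apply_symm_apply l]
    · rw [show σ (σ⁻¹ l) = l from σ.apply_symm_apply l]
      refine hlj.trans_le ?_
      rcases lt_trichotomy (σ⁻¹ j) r with h | h | h
      · have := htie _ _ h (by rw [show σ (σ⁻¹ j) = j from σ.apply_symm_apply j, hj, hr])
        rw [show σ (σ⁻¹ j) = j from σ.apply_symm_apply j] at this
        exact this.le
      · rw [← h, show σ (σ⁻¹ j) = j from σ.apply_symm_apply j]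
      · have := hr' _ h
        rw [show σ (σ⁻¹ j) = j from σ.apply_symm_apply j] at this
        omega
  have hstep : ∀ (i : ℕ) (hi : i + 1 < n), d (σ ⟨i, by omega⟩) =
      d (σ ⟨i + 1, hi⟩) + if i ∈ permDes σ then 1 else 0 := by
    intro i hi
    have hle := hmono ⟨i, by omega⟩ ⟨i + 1, hi⟩ (by simp)
    rcases hle.eq_or_lt with he | hlt
    · have := htie ⟨i, by omega⟩ ⟨i + 1, hi⟩ (by simp) he.symm
      rw [if_neg, add_zero, he]
      rw [mem_permDes]
      rintro ⟨_, h⟩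
      exact lt_asymm this h
    · obtain ⟨c, hc⟩ : ∃ c, d (σ ⟨i, by omega⟩) = c + 1 := ⟨d (σ ⟨i, by omega⟩) - 1, by omega⟩
      obtain ⟨q, hq, hqc, hq'⟩ := hlast c _ hc
      have hqle := hmono ⟨i + 1, hi⟩ q hq
      have hsuc : d (σ ⟨i + 1, hi⟩) = c := by omega
      rw [if_pos, hc, hsuc]
      rw [mem_permDes]
      refine ⟨hi, ?_⟩
      rw [inv_inv]
      refine lt_of_le_of_lt ?_ (hq' _ hc fun s hs => ?_)
      · rcases (show (⟨i + 1, hi⟩ : Fin n) ≤ q from hq).eq_or_lt with h | h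
        · rw [h]
        · exact (htie _ _ h (hsuc.trans hqc.symm)).le
      · rw [← hsuc]
        exact hmono _ _ hs
  have hall : ∀ (m i : ℕ) (hi : i + m + 1 = n),
      d (σ ⟨i, by omega⟩) = expI n (permDes σ) ⟨i, by omega⟩ := by
    intro m
    induction m with
    | zero =>
      intro i hi
      have h₁ : d (σ ⟨i, by omega⟩) = 0 := by
        by_contra h
        obtain ⟨q, hq, -⟩ := hlast (d (σ ⟨i, by omega⟩) - 1) ⟨i, by omega⟩ (by omega)
        rw [Fin.lt_def] at hq
        have := q.2
        dsimp only at hq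
        omega
      rw [h₁, eq_comm]
      unfold expI
      rw [Finset.card_eq_zero, Finset.filter_eq_empty_iff]
      intro j hj hij
      obtain ⟨h, -⟩ := mem_permDes.1 hj
      dsimp only at hij
      omega
    | succ m ih =>
      intro i hi
      rw [hstep i (by omega), ih (i + 1) (by omega)]
      split_ifs with h
      · rw [expI_of_mem (by omega) h]
      · rw [expI_of_notMem (by omega) h, add_zero]
  refine ⟨σ, Finsupp.ext fun j => ?_⟩
  rw [permExp_apply, ← hall (n - 1 - σ⁻¹ j) (σ⁻¹ j) (by omega)]
  exact congrArg d (σ.apply_symm_apply j).symm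

variable {F : Type*} [Field F] {A : ℕ → Module.End F (MvPolynomial (Fin n) F)}

/-- The leading monomial of `π̄_w x_I`. -/
theorem IsDemazureBar.heckeLift_xI_sub_mem (hA : IsDemazureBar A) {w : Equiv.Perm (Fin n)}
    {I : Finset ℕ} (h : permDes w ⊆ I) :
    heckeLift A w (xI F n I) - monomial (permExp w (expI n I)) 1 ∈
      lowSpan F n (∑ j, expI n I j) (∑ j, expI n I j ^ 2) := by
  induction w using perm_induction with
  | one => simp [heckeLift_one, xI_eq_monomial]
  | step i w hi ih =>
    have hlow := hA.map_lowSpan_le hi.1 _ _ (ih ((permDes_subset_sw_mul hi).trans h))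
    rw [map_sub] at hlow
    rw [heckeLift_sw_mul hA.comm hA.braid hi, Module.End.mul_apply]
    obtain ⟨hin, hlt⟩ := hi
    have hle : permExp w (expI n I) ⟨i + 1, hin⟩ ≤ permExp w (expI n I) ⟨i, by omega⟩ :=
      expI_antitone I hlt.le
    have hpos : permExp w (expI n I) ⟨i + 1, hin⟩ < permExp w (expI n I) ⟨i, by omega⟩ := by
      refine hle.lt_of_ne fun heq => ?_
      have := lt_of_forall_notMem_permDes (w := sw n i * w) hlt fun r h₁ h₂ hr =>
        notMem_of_expI_eq hlt.le heq.symm h₁ h₂ (h hr)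
      simp [sw_apply_left hin, sw_apply_right hin, Fin.lt_def] at this
    have hdeg := degree_permExp w (expI n I)
    have hsq := sqNorm_permExp w (expI n I)
    obtain ⟨e, he, hd⟩ := exists_symmetric_add_single _ hle
    rw [permExp_sw_mul w _ hin he hd]
    have := hA.apply_monomial_sub_mem hin he (Nat.sub_pos_of_lt hpos)
    rw [← hd, hsq] at this
    rw [hd, map_add, Finsupp.degree_single] at hdeg
    rw [hdeg] at this
    simpa using add_mem hlow this

theorem IsDemazureBar.heckeLift_xI_eq_zero (hA : IsDemazureBar A) {w : Equiv.Perm (Fin n)}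
    {I : Finset ℕ} (h : ¬permDes w ⊆ I) : heckeLift A w (xI F n I) = 0 := by
  obtain ⟨i, hi, hiI⟩ := Finset.not_subset.1 h
  rw [mem_permDes] at hi
  have hasc : LeftAscent (w * sw n i)⁻¹ i := by
    rwa [mul_inv_rev, sw_inv, leftAscent_sw_mul]
  have hT := heckeLift_mul_sw hA.comm hA.braid hasc
  rw [mul_assoc, sw_mul_self, mul_one] at hT
  have := hA.apply_monomial_left hi.1 (e := permExp 1 (expI n I)) (expI_of_notMem hi.1 hiI) 0
  rw [Finsupp.single_zero, add_zero, Finset.sum_range_zero, ← xI_eq_monomial] at this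
  rw [hT, Module.End.mul_apply, this, map_zero]

end LeadingTerms

section Straightening

variable {n : ℕ}

/-- The exponent of the square-free monomial on the variables in `S`. -/
noncomputable def indExp (S : Finset (Fin n)) : Fin n →₀ ℕ := ∑ j ∈ S, Finsupp.single j 1

theorem indExp_apply (S : Finset (Fin n)) (j : Fin n) : indExp S j = if j ∈ S then 1 else 0 := by
  unfold indExp
  rw [Finsupp.finsetSum_apply]
  simp [Finsupp.single_apply]

theorem degree_indExp (S : Finset (Fin n)) : (indExp S).degree = S.card := by
  unfold indExp
  simp

/-- The sum of the exponents weighted by the positions of the variables. -/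
def posSum (d : Fin n →₀ ℕ) : ℕ := ∑ j : Fin n, (j : ℕ) * d j

theorem posSum_le (d : Fin n →₀ ℕ) : posSum d ≤ n * d.degree := by
  rw [Finsupp.degree_eq_sum, Finset.mul_sum]
  exact Finset.sum_le_sum fun j _ => Nat.mul_le_mul_right _ j.2.le

theorem posSum_add_indExp (d : Fin n →₀ ℕ) (S : Finset (Fin n)) :
    posSum (d + indExp S) = posSum d + ∑ j ∈ S, (j : ℕ) := by
  unfold posSum
  simp [indExp_apply, mul_add, Finset.sum_add_distrib]

theorem sqNorm_add_indExp (d : Fin n →₀ ℕ) (S : Finset (Fin n)) :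
    sqNorm (d + indExp S) = sqNorm d + 2 * ∑ j ∈ S, d j + S.card := by
  unfold sqNorm
  rw [Finset.mul_sum, Finset.card_eq_sum_ones, add_assoc, ← Finset.sum_add_distrib,
    ← Finset.sum_filter_add_sum_filter_not Finset.univ (· ∈ S) fun j => d j ^ 2,
    ← Finset.sum_filter_add_sum_filter_not Finset.univ (· ∈ S) fun j => (d + indExp S) j ^ 2,
    add_right_comm]
  simp only [Finset.filter_mem_eq_inter, Finset.univ_inter]
  rw [← Finset.sum_add_distrib]
  congr 1
  · refine Finset.sum_congr rfl fun j hj => ?_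
    rw [Finsupp.add_apply, indExp_apply, if_pos hj]
    ring
  · refine Finset.sum_congr rfl fun j hj => ?_
    rw [Finsupp.add_apply, indExp_apply, if_neg (Finset.mem_filter.1 hj).2, add_zero]

/-- Among the sets `S` of the size of `T`, the upper level set `T` gives the leading term of
`e_r x^d`, if ties are resolved in favour of small positions. -/
theorem sqNorm_lt_or_posSum_lt {d : Fin n →₀ ℕ} {c : ℕ} {S T : Finset (Fin n)}
    (hcard : S.card = T.card) (hne : S ≠ T) (hT : ∀ j ∈ T, c ≤ d j) (hT' : ∀ j ∉ T, d j ≤ c)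
    (htie : ∀ j ∈ T, ∀ l ∉ T, d j = c → d l = c → j < l) :
    sqNorm (d + indExp S) < sqNorm (d + indExp T) ∨
      sqNorm (d + indExp S) = sqNorm (d + indExp T) ∧
        posSum (d + indExp T) < posSum (d + indExp S) := by
  rw [sqNorm_add_indExp, sqNorm_add_indExp, posSum_add_indExp, posSum_add_indExp, hcard]
  have hc := Finset.card_sdiff_comm hcard
  have hne' : (T \ S).Nonempty := by
    rw [Finset.sdiff_nonempty]
    exact fun h => hne (Finset.eq_of_subset_of_card_le h hcard.le).symm
  have split : ∀ f : Fin n → ℕ, ∑ j ∈ S \ T, f j + ∑ j ∈ T, f j = ∑ j ∈ T \ S, f j + ∑ j ∈ S, f j := by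
    intro f
    rw [← Finset.sum_sdiff (Finset.inter_subset_left : S ∩ T ⊆ S),
      ← Finset.sum_sdiff (Finset.inter_subset_right : S ∩ T ⊆ T), Finset.sdiff_inter_self_left,
      Finset.sdiff_inter_self_right]
    ring
  have h₁ : ∑ j ∈ S \ T, d j ≤ (S \ T).card * c :=
    Finset.sum_le_card_nsmul _ _ _ fun j hj => hT' j (Finset.mem_sdiff.1 hj).2
  have h₂ : (T \ S).card * c ≤ ∑ j ∈ T \ S, d j :=
    Finset.card_nsmul_le_sum _ _ _ fun j hj => hT j (Finset.mem_sdiff.1 hj).1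
  rw [hc] at h₁
  have hd := split d
  rcases (h₁.trans h₂).eq_or_lt with heq | hlt
  · refine Or.inr ⟨by omega, ?_⟩
    have e₁ : ∑ j ∈ S \ T, d j = ∑ j ∈ S \ T, c := by
      rw [Finset.sum_const, smul_eq_mul, hc]
      omega
    have e₂ : ∑ j ∈ T \ S, c = ∑ j ∈ T \ S, d j := by
      rw [Finset.sum_const, smul_eq_mul]
      omega
    rw [Finset.sum_eq_sum_iff_of_le fun j hj => hT' j (Finset.mem_sdiff.1 hj).2] at e₁
    rw [Finset.sum_eq_sum_iff_of_le fun j hj => hT j (Finset.mem_sdiff.1 hj).1] at e₂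
    have hlt : ∀ j ∈ T \ S, ∀ l ∈ S \ T, j < l := fun j hj l hl =>
      htie j (Finset.mem_sdiff.1 hj).1 l (Finset.mem_sdiff.1 hl).2 (e₂ j hj).symm (e₁ l hl)
    have hneS : (S \ T).Nonempty := by
      rw [← Finset.card_pos, hc, Finset.card_pos]
      exact hne'
    obtain ⟨m, hm, hmin⟩ := (S \ T).exists_min_image id hneS
    have p₁ : ∑ j ∈ T \ S, (j : ℕ) < (T \ S).card * m := by
      rw [← smul_eq_mul, ← Finset.sum_const]
      exact Finset.sum_lt_sum_of_nonempty hne' fun j hj => hlt j hj m hm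
    have p₂ : (S \ T).card * (m : ℕ) ≤ ∑ j ∈ S \ T, (j : ℕ) :=
      Finset.card_nsmul_le_sum _ _ _ fun j hj => hmin j hj
    rw [hc] at p₂
    have := split fun j => (j : ℕ)
    omega
  · left
    omega

variable {F : Type*} [Field F] {A : ℕ → Module.End F (MvPolynomial (Fin n) F)}

theorem lowSpan_mono (k : ℕ) {t t' : ℕ} (h : t ≤ t') : lowSpan F n k t ≤ lowSpan F n k t' :=
  Submodule.span_mono (Set.image_mono fun _ hd => ⟨hd.1, hd.2.trans_le h⟩)

theorem esymm_mul_monomial (r : ℕ) (d : Fin n →₀ ℕ) :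
    esymm (Fin n) F r * monomial d 1 =
      ∑ S ∈ Finset.powersetCard r Finset.univ, monomial (d + indExp S) 1 := by
  rw [esymm_eq_sum_monomial, Finset.sum_mul]
  refine Finset.sum_congr rfl fun S _ => ?_
  rw [monomial_mul, one_mul, add_comm]
  rfl

/-- Straightening: a space of polynomials that contains the degree `k` elements
`e_r x^d` (`r ≥ 1`) and `π̄_w x_{D(w)}` contains all polynomials of degree `k`. -/
theorem IsDemazureBar.lowSpan_le (hA : IsDemazureBar A)
    {M : Submodule F (MvPolynomial (Fin n) F)} {k : ℕ}
    (hE : ∀ r, 1 ≤ r → ∀ d : Fin n →₀ ℕ, d.degree + r = k →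
      esymm (Fin n) F r * monomial d 1 ∈ M)
    (hB : ∀ w : Equiv.Perm (Fin n), ∑ j, expI n (permDes w) j = k →
      heckeLift A w (xI F n (permDes w)) ∈ M) (t : ℕ) : lowSpan F n k t ≤ M := by
  induction t with
  | zero =>
    refine Submodule.span_le.2 ?_
    rintro _ ⟨d, ⟨-, h⟩, -⟩
    exact absurd h (Nat.not_lt_zero _)
  | succ t ih =>
    have key : ∀ (N : ℕ) (d : Fin n →₀ ℕ), n * k - posSum d = N → d.degree = k →
        sqNorm d < t + 1 → monomial d (1 : F) ∈ M := by
      intro N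
      induction N using Nat.strong_induction_on with
      | _ N ihN =>
        intro d hN hk hsq
        by_cases hd : ∀ c, (∃ j, c + 1 ≤ d j) → ∃ j l, d j = c + 1 ∧ d l = c ∧ l < j
        · obtain ⟨w, hw⟩ := exists_eq_permExp d hd
          have hdeg := degree_permExp w (expI n (permDes w))
          have hs := sqNorm_permExp w (expI n (permDes w))
          rw [← hw] at hdeg hs
          have hlow := hA.heckeLift_xI_sub_mem (Finset.Subset.refl (permDes w))
          rw [← hw, ← hdeg, ← hs, hk] at hlow
          have := sub_mem (hB w (hdeg.symm.trans hk))
            (ih (lowSpan_mono k (Nat.lt_succ_iff.1 hsq) hlow))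
          rwa [sub_sub_cancel] at this
        · push Not at hd
          obtain ⟨c, ⟨j₀, hj₀⟩, hc⟩ := hd
          set T : Finset (Fin n) := Finset.univ.filter fun j => c + 1 ≤ d j with hT
          have memT : ∀ j, j ∈ T ↔ c + 1 ≤ d j := fun j => by simp [hT]
          have hle : indExp T ≤ d := fun j => by
            rw [indExp_apply]
            split_ifs with h
            · have := (memT j).1 h
              omega
            · exact Nat.zero_le _
          set d' := d - indExp T with hd'
          have hdd : d' + indExp T = d := tsub_add_cancel_of_le hle
          have hd'T : ∀ j ∈ T, d' j + 1 = d j := fun j hj => by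
            have := DFunLike.congr_fun hdd j
            rwa [Finsupp.add_apply, indExp_apply, if_pos hj] at this
          have hd'T' : ∀ j ∉ T, d' j = d j := fun j hj => by
            have := DFunLike.congr_fun hdd j
            rwa [Finsupp.add_apply, indExp_apply, if_neg hj, add_zero] at this
          have hdeg : d'.degree + T.card = k := by
            rw [← hk, ← hdd, map_add, degree_indExp]
          have hmem := hE T.card (Finset.card_pos.2 ⟨j₀, (memT _).2 hj₀⟩) d' hdeg
          rw [esymm_mul_monomial, ← Finset.add_sum_erase _ _ (Finset.mem_powersetCard.2
            ⟨Finset.subset_univ T, rfl⟩), hdd] at hmem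
          refine (Submodule.add_mem_iff_left M (Submodule.sum_mem _ fun S hS => ?_)).1 hmem
          obtain ⟨hne, hS⟩ := Finset.mem_erase.1 hS
          have hcard := (Finset.mem_powersetCard.1 hS).2
          have hkS : (d' + indExp S).degree = k := by
            rw [map_add, degree_indExp, hcard, hdeg]
          rcases sqNorm_lt_or_posSum_lt (d := d') (c := c) hcard hne
            (fun j hj => by have := hd'T j hj; have := (memT j).1 hj; omega)
            (fun j hj => by have := hd'T' j hj; have := mt (memT j).2 hj; omega)
            (fun j hj l hl h₁ h₂ => by
              refine (hc j l (by rw [← hd'T j hj, h₁]) (by rw [← hd'T' l hl, h₂])).lt_of_ne ?_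
              rintro rfl
              exact hl hj) with hlt | ⟨heq, hlt⟩
          · rw [hdd] at hlt
            exact ih (monomial_mem_lowSpan hkS (by omega))
          · rw [hdd] at heq hlt
            have := posSum_le (d' + indExp S)
            rw [hkS] at this
            exact ihN _ (by omega) _ rfl hkS (by omega)
    refine Submodule.span_le.2 ?_
    rintro _ ⟨d, ⟨hk, h⟩, rfl⟩
    exact key _ d rfl hk h

end Straightening

section Coinvariants

variable {n : ℕ} {F : Type*} [Field F]

/-- A family of `n!` polynomials spanning over the symmetric polynomials is linearly
independent over them, by Dedekind's independence of the `n!` variable permutations. -/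
theorem eq_zero_of_span_symmetric {b : Equiv.Perm (Fin n) → MvPolynomial (Fin n) F}
    (hb : ∀ f : MvPolynomial (Fin n) F, ∃ a : Equiv.Perm (Fin n) → MvPolynomial (Fin n) F,
      (∀ w, (a w).IsSymmetric) ∧ f = ∑ w, a w * b w)
    {c : Equiv.Perm (Fin n) → MvPolynomial (Fin n) F} (hc : ∀ w, (c w).IsSymmetric)
    (h : ∑ w, c w * b w = 0) : c = 0 := by
  let M : Matrix (Equiv.Perm (Fin n)) (Equiv.Perm (Fin n)) (MvPolynomial (Fin n) F) :=
    fun σ w => rename σ (b w)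
  have hdet : M.det ≠ 0 := by
    intro hdet
    obtain ⟨y, hy, hyM⟩ := Matrix.exists_vecMul_eq_zero_iff.2 hdet
    let χ : Equiv.Perm (Fin n) → (MvPolynomial (Fin n) F →* MvPolynomial (Fin n) F) :=
      fun σ => (rename σ : _ →ₐ[F] MvPolynomial (Fin n) F)
    have hχ : Function.Injective χ := by
      intro σ τ hστ
      refine Equiv.ext fun j => ?_
      have := DFunLike.congr_fun hστ (X j)
      simpa [χ] using this
    have hind := (linearIndependent_monoidHom (MvPolynomial (Fin n) F)
      (MvPolynomial (Fin n) F)).comp χ hχ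
    rw [Fintype.linearIndependent_iff] at hind
    refine hy (funext fun σ => hind y (funext fun f => ?_) σ)
    obtain ⟨a, ha, rfl⟩ := hb f
    simp only [Function.comp_apply, Finset.sum_apply, Pi.smul_apply, smul_eq_mul, Pi.zero_apply]
    have hrow : ∀ w, ∑ σ : Equiv.Perm (Fin n), y σ * rename σ (b w) = 0 :=
      fun w => congrFun hyM w
    calc ∑ σ, y σ * χ σ (∑ w, a w * b w)
        = ∑ σ : Equiv.Perm (Fin n), ∑ w, a w * (y σ * rename σ (b w)) := by
          refine Finset.sum_congr rfl fun σ _ => ?_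
          change y σ * rename σ (∑ w, a w * b w) = _
          rw [map_sum, Finset.mul_sum]
          refine Finset.sum_congr rfl fun w _ => ?_
          rw [map_mul, ha w σ, mul_left_comm]
      _ = 0 := by
          rw [Finset.sum_comm]
          refine Finset.sum_eq_zero fun w _ => ?_
          rw [← Finset.mul_sum, hrow, mul_zero]
  by_contra hc0
  refine hdet (Matrix.exists_mulVec_eq_zero_iff.1 ⟨c, hc0, funext fun σ => ?_⟩)
  have := congrArg (rename σ) h
  rw [map_sum, map_zero] at this
  rw [Pi.zero_apply, ← this]
  refine Finset.sum_congr rfl fun w _ => ?_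
  rw [map_mul, hc w σ, mul_comm]

/-- A basis over the symmetric polynomials gives a basis of the coinvariant algebra. -/
theorem finrank_coinvariant {b : Equiv.Perm (Fin n) → MvPolynomial (Fin n) F}
    (hb : ∀ f : MvPolynomial (Fin n) F, ∃ a : Equiv.Perm (Fin n) → MvPolynomial (Fin n) F,
      (∀ w, (a w).IsSymmetric) ∧ f = ∑ w, a w * b w) :
    Module.finrank F (MvPolynomial (Fin n) F ⧸ coinvIdeal n F) =
      Fintype.card (Equiv.Perm (Fin n)) := by
  have hI : ∀ z ∈ coinvIdeal n F, ∀ f, ∃ a : Equiv.Perm (Fin n) → MvPolynomial (Fin n) F,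
      (∀ w, (a w).IsSymmetric ∧ constantCoeff (a w) = 0) ∧ f * z = ∑ w, a w * b w := by
    intro z hz
    induction hz using Submodule.span_induction with
    | mem p hp =>
      intro f
      obtain ⟨a, ha, rfl⟩ := hb f
      refine ⟨fun w => p * a w, fun w => ⟨hp.1.mul (ha w), ?_⟩, ?_⟩
      · rw [map_mul, hp.2, zero_mul]
      · rw [Finset.sum_mul]
        exact Finset.sum_congr rfl fun w _ => by ring
    | zero => exact fun f => ⟨0, fun w => ⟨IsSymmetric.zero, map_zero _⟩, by simp⟩
    | add x y _ _ hx hy =>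
      intro f
      obtain ⟨a, ha, hax⟩ := hx f
      obtain ⟨a', ha', hay⟩ := hy f
      refine ⟨a + a', fun w => ⟨(ha w).1.add (ha' w).1, ?_⟩, ?_⟩
      · rw [Pi.add_apply, map_add, (ha w).2, (ha' w).2, add_zero]
      · rw [mul_add, hax, hay, ← Finset.sum_add_distrib]
        exact Finset.sum_congr rfl fun w _ => (add_mul _ _ _).symm
    | smul r x _ hx =>
      intro f
      rw [smul_eq_mul, ← mul_assoc]
      exact hx (f * r)
  let mk := (Ideal.Quotient.mkₐ F (coinvIdeal n F)).toLinearMap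
  have hmk : ∀ f, mk f = 0 ↔ f ∈ coinvIdeal n F := fun f => Ideal.Quotient.eq_zero_iff_mem
  have hli : LinearIndependent F fun w => mk (b w) := by
    rw [Fintype.linearIndependent_iff]
    intro c hc w
    have hmem : ∑ w, c w • b w ∈ coinvIdeal n F := by
      rw [← hmk, map_sum, ← hc]
      simp only [map_smul]
    obtain ⟨a, ha, hsum⟩ := hI _ hmem 1
    have hzero := eq_zero_of_span_symmetric hb (c := fun w => C (c w) - a w)
      (fun w => (IsSymmetric.C _).sub (ha w).1) (by
        simp only [sub_mul, Finset.sum_sub_distrib, ← hsum, one_mul, smul_eq_C_mul, sub_self])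
    have := congrArg constantCoeff (congrFun hzero w)
    rwa [map_sub, (ha w).2, sub_zero, constantCoeff_C, Pi.zero_apply, map_zero] at this
  have hspan : ⊤ ≤ Submodule.span F (Set.range fun w => mk (b w)) := by
    rintro x -
    obtain ⟨f, rfl⟩ := Ideal.Quotient.mk_surjective x
    obtain ⟨a, ha, rfl⟩ := hb f
    rw [map_sum]
    refine Submodule.sum_mem _ fun w _ => ?_
    have : Ideal.Quotient.mk (coinvIdeal n F) (a w * b w) = constantCoeff (a w) • mk (b w) := by
      rw [← map_smul, smul_eq_C_mul]
      refine Ideal.Quotient.eq.2 ?_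
      rw [← sub_mul]
      refine Ideal.mul_mem_right _ _ (Ideal.subset_span ⟨(ha w).sub (IsSymmetric.C _), ?_⟩)
      rw [map_sub, constantCoeff_C, sub_self]
    rw [this]
    exact Submodule.smul_mem _ _ (Submodule.subset_span ⟨w, rfl⟩)
  exact Module.finrank_eq_card_basis (Module.Basis.mk hli hspan)

theorem esymm_mem_coinvIdeal {r : ℕ} (hr : 1 ≤ r) : esymm (Fin n) F r ∈ coinvIdeal n F := by
  refine Ideal.subset_span ⟨esymm_isSymmetric _ _ _, ?_⟩
  rw [esymm, map_sum]
  refine Finset.sum_eq_zero fun S hS => ?_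
  rw [map_prod]
  obtain ⟨j, hj⟩ := Finset.card_pos.1 (hr.trans (Finset.mem_powersetCard.1 hS).2.ge)
  exact Finset.prod_eq_zero hj (by simp)

theorem sum_expI_le {I : Finset ℕ} (hI : I ⊆ Finset.range (n - 1)) :
    ∑ j, expI n I j ≤ n * n := by
  refine (Finset.sum_le_card_nsmul _ _ n fun j _ => ?_).trans (by simp)
  refine (Finset.card_filter_le _ _).trans ((Finset.card_le_card hI).trans ?_)
  rw [Finset.card_range]
  exact Nat.sub_le _ _

theorem sum_expI_lt_sum_expI (hn : 1 ≤ n) {I J : Finset ℕ} (hIJ : I ⊂ J) :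
    ∑ j, expI n I j < ∑ j, expI n J j := by
  refine Finset.sum_lt_sum (fun j _ => Finset.card_le_card
    (Finset.filter_subset_filter _ hIJ.subset)) ⟨⟨0, hn⟩, Finset.mem_univ _, ?_⟩
  simpa [expI] using Finset.card_lt_card hIJ

theorem eq_top_of_lowSpan_le {M : Submodule F (MvPolynomial (Fin n) F)}
    (h : ∀ k t, lowSpan F n k t ≤ M) (f : MvPolynomial (Fin n) F) : f ∈ M := by
  rw [f.as_sum]
  refine Submodule.sum_mem _ fun d _ => ?_
  rw [← mul_one (coeff d f), ← smul_eq_mul, ← smul_monomial]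
  exact Submodule.smul_mem _ _ (h _ _ (monomial_mem_lowSpan rfl (Nat.lt_succ_self _)))

variable (F n) in
/-- The sum of all `x_I`, a cyclic generator of the coinvariant algebra. -/
noncomputable def coinvGen : MvPolynomial (Fin n) F :=
  ∑ I ∈ (Finset.range (n - 1)).powerset, xI F n I

namespace IsDemazureBar

variable {A : ℕ → Module.End F (MvPolynomial (Fin n) F)}

/-- The polynomials `π̄_w x_{D(w)}` span over the symmetric polynomials. -/
theorem exists_eq_sum_symmetric_mul (hA : IsDemazureBar A) (f : MvPolynomial (Fin n) F) :
    ∃ a : Equiv.Perm (Fin n) → MvPolynomial (Fin n) F,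
      (∀ w, (a w).IsSymmetric) ∧ f = ∑ w, a w * heckeLift A w (xI F n (permDes w)) := by
  have hle : ∀ k t, lowSpan F n k t ≤ (Submodule.span (symmetricSubalgebra (Fin n) F)
      (Set.range fun w : Equiv.Perm (Fin n) =>
        heckeLift A w (xI F n (permDes w)))).restrictScalars F := by
    intro k
    induction k using Nat.strong_induction_on with
    | _ k ih =>
      refine hA.lowSpan_le (fun r hr d hd => ?_) fun w _ => Submodule.subset_span ⟨w, rfl⟩
      exact Submodule.smul_mem _ (⟨esymm (Fin n) F r, esymm_isSymmetric _ _ _⟩ :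
          symmetricSubalgebra (Fin n) F)
        (ih d.degree (by omega) _ (monomial_mem_lowSpan rfl (Nat.lt_succ_self _)))
  obtain ⟨c, hc⟩ := (Submodule.mem_span_range_iff_exists_fun _).1 (eq_top_of_lowSpan_le hle f)
  exact ⟨fun w => c w, fun w => (c w).2, hc.symm⟩

/-- The elements `π̄_w v`, where `v` is the sum of all `x_I`, span the coinvariant algebra. -/
theorem span_heckeLift_coinvGen (hA : IsDemazureBar A) (hn : 1 ≤ n) :
    ⊤ ≤ Submodule.span F (Set.range fun w : Equiv.Perm (Fin n) =>
      Ideal.Quotient.mk (coinvIdeal n F) (heckeLift A w (coinvGen n F))) := by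
  set N := Submodule.span F (Set.range fun w : Equiv.Perm (Fin n) =>
      Ideal.Quotient.mk (coinvIdeal n F) (heckeLift A w (coinvGen n F)))
  set M := N.comap (Ideal.Quotient.mkₐ F (coinvIdeal n F)).toLinearMap
  have hE : ∀ r, 1 ≤ r → ∀ d : Fin n →₀ ℕ, esymm (Fin n) F r * monomial d 1 ∈ M := by
    intro r hr d
    have : Ideal.Quotient.mk (coinvIdeal n F) (esymm (Fin n) F r * monomial d 1) = 0 :=
      Ideal.Quotient.eq_zero_iff_mem.2 (Ideal.mul_mem_right _ _ (esymm_mem_coinvIdeal hr))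
    change Ideal.Quotient.mk (coinvIdeal n F) _ ∈ N
    rw [this]
    exact zero_mem _
  have hle : ∀ m k, n * n < k + m → ∀ t, lowSpan F n k t ≤ M := by
    intro m
    induction m with
    | zero =>
      intro k hk
      refine hA.lowSpan_le (fun r hr d _ => hE r hr d) fun w hw => ?_
      have : ∑ j, expI n (permDes w) j ≤ n * n := sum_expI_le (Finset.filter_subset _ _)
      omega
    | succ m ih =>
      intro k hk
      refine hA.lowSpan_le (fun r hr d _ => hE r hr d) fun w hw => ?_
      have hgen : heckeLift A w (coinvGen n F) ∈ M := Submodule.subset_span ⟨w, rfl⟩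
      rw [coinvGen, map_sum, ← Finset.add_sum_erase _ _ (Finset.mem_powerset.2
        (Finset.filter_subset _ _ : permDes w ⊆ Finset.range (n - 1)))] at hgen
      refine (Submodule.add_mem_iff_left M (Submodule.sum_mem _ fun J hJ => ?_)).1 hgen
      by_cases hDJ : permDes w ⊆ J
      · have hlt := sum_expI_lt_sum_expI hn
          (hDJ.ssubset_of_ne (Finset.ne_of_mem_erase hJ).symm)
        refine ih (∑ j, expI n J j) (by omega) (sqNorm (permExp 1 (expI n J)) + 1)
          (hA.heckeLift_mem_lowSpan w _ _ ?_)
        rw [xI_eq_monomial]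
        exact monomial_mem_lowSpan (degree_permExp _ _) (Nat.lt_succ_self _)
      · rw [hA.heckeLift_xI_eq_zero hDJ]
        exact zero_mem _
  rintro x -
  obtain ⟨f, rfl⟩ := Ideal.Quotient.mk_surjective x
  exact eq_top_of_lowSpan_le (M := M) (fun k => hle (n * n + 1) k (by omega)) f

theorem map_coinvIdeal (hA : IsDemazureBar A) {i : ℕ} (hi : i + 1 < n)
    {z : MvPolynomial (Fin n) F} (hz : z ∈ coinvIdeal n F) : A i z ∈ coinvIdeal n F := by
  suffices h : ∀ f, A i (f * z) ∈ coinvIdeal n F by simpa using h 1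
  induction hz using Submodule.span_induction with
  | mem p hp =>
    intro f
    rw [mul_comm, hA.map_mul_of_rename_eq hi (hp.1 _)]
    exact Ideal.mul_mem_right _ _ (Ideal.subset_span hp)
  | zero => simp
  | add x y _ _ hx hy =>
    intro f
    rw [mul_add, map_add]
    exact add_mem (hx f) (hy f)
  | smul r x _ hx =>
    intro f
    rw [smul_eq_mul, ← mul_assoc]
    exact hx (f * r)

theorem exists_equiv_regular (hA : IsDemazureBar A) (hn : 1 ≤ n) :
    ∃ φ : (MvPolynomial (Fin n) F ⧸ coinvIdeal n F) ≃ₗ[F] (Equiv.Perm (Fin n) →₀ F),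
      ∀ (i : ℕ), i + 1 < n → ∀ f : MvPolynomial (Fin n) F,
        φ (Ideal.Quotient.mk (coinvIdeal n F) (A i f))
          = Lop F n i (φ (Ideal.Quotient.mk (coinvIdeal n F) f)) := by
  let mk := (Ideal.Quotient.mkₐ F (coinvIdeal n F)).toLinearMap
  let e := basisOfTopLeSpanOfCardEqFinrank _ (hA.span_heckeLift_coinvGen hn)
    (finrank_coinvariant hA.exists_eq_sum_symmetric_mul).symm
  have he : ∀ w, mk (heckeLift A w (coinvGen n F)) = e w := fun w =>
    (congrFun (coe_basisOfTopLeSpanOfCardEqFinrank _ (hA.span_heckeLift_coinvGen hn)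
      (finrank_coinvariant hA.exists_eq_sum_symmetric_mul).symm) w).symm
  refine ⟨e.repr, fun i hi f => ?_⟩
  change e.repr (mk (A i f)) = Lop F n i (e.repr (mk f))
  have key : ∀ w, e.repr (mk (A i (heckeLift A w (coinvGen n F)))) =
      Lop F n i (Finsupp.single w 1) := by
    intro w
    rw [Lop, Finsupp.lsum_single, LinearMap.toSpanSingleton_apply, one_smul]
    rcases leftAscent_or_leftDescent w hi with h | h
    · rw [if_pos (by rw [invNum_sw_mul h]; omega), ← Module.End.mul_apply,
        ← heckeLift_sw_mul hA.comm hA.braid h, he, Module.Basis.repr_self]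
    · have hlen := invNum_sw_mul_of_leftDescent h
      rw [if_neg (by omega), heckeLift_of_leftDescent hA.comm hA.braid h, Module.End.mul_apply,
        hA.apply_self hi, ← Module.End.mul_apply,
        ← heckeLift_of_leftDescent hA.comm hA.braid h, map_neg, map_neg, he,
        Module.Basis.repr_self]
  have hf : mk f = mk (∑ w, e.repr (mk f) w • heckeLift A w (coinvGen n F)) := by
    conv_lhs => rw [← e.sum_repr (mk f)]
    simp only [map_sum, map_smul, he]
  have hAf : mk (A i f) = mk (A i (∑ w, e.repr (mk f) w • heckeLift A w (coinvGen n F))) := by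
    refine Ideal.Quotient.eq.2 ?_
    rw [← map_sub]
    exact hA.map_coinvIdeal hi (Ideal.Quotient.eq.1 hf)
  rw [hAf]
  simp only [map_sum, map_smul, key]
  rw [← Finsupp.univ_sum_single (e.repr (mk f)), map_sum]
  refine Finset.sum_congr rfl fun w _ => ?_
  rw [← map_smul, Finsupp.smul_single, smul_eq_mul, mul_one, Finsupp.univ_sum_single]

end IsDemazureBar

end Coinvariants

/-- **Theorem 1.2.**  The coinvariant algebra `F[x]/(F[x]^{𝔖_n}_+)`, with the operators
`π̄_i` induced by the Demazure operators (characterized by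
`(x_i - x_{i+1}) π_i f = x_i f - x_{i+1} s_i(f)`, `π̄_i = π_i - 1`), is isomorphic to the
left regular representation of the 0-Hecke algebra `H_n(0)` in its standard basis. -/
theorem stmt_9 (n : ℕ) (hn : 1 ≤ n) (F : Type*) [Field F]
    (dem : ℕ → MvPolynomial (Fin n) F → MvPolynomial (Fin n) F)
    (hdem : ∀ (i : ℕ) (hi : i + 1 < n) (f : MvPolynomial (Fin n) F),
      (X (⟨i, Nat.lt_of_succ_lt hi⟩ : Fin n) - X ⟨i + 1, hi⟩) * dem i f
        = X (⟨i, Nat.lt_of_succ_lt hi⟩ : Fin n) * f - X ⟨i + 1, hi⟩ * rename (sw n i) f) :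
    ∃ φ : (MvPolynomial (Fin n) F ⧸ coinvIdeal n F) ≃ₗ[F] (Equiv.Perm (Fin n) →₀ F),
      ∀ (i : ℕ), i + 1 < n → ∀ f : MvPolynomial (Fin n) F,
        φ (Ideal.Quotient.mk (coinvIdeal n F) (dem i f - f))
          = Lop F n i (φ (Ideal.Quotient.mk (coinvIdeal n F) f)) := by
  have hne (i : ℕ) (hi : i + 1 < n) :
      (X (⟨i, Nat.lt_of_succ_lt hi⟩ : Fin n) - X ⟨i + 1, hi⟩ : MvPolynomial (Fin n) F) ≠ 0 :=
    X_sub_X_ne_zero (by simp)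
  let A : ℕ → Module.End F (MvPolynomial (Fin n) F) := fun i =>
    if hi : i + 1 < n then
      { toFun := fun f => dem i f - f
        map_add' := fun f g => mul_left_cancel₀ (hne i hi) (by
          have h := hdem i hi (f + g)
          rw [map_add] at h
          linear_combination h - hdem i hi f - hdem i hi g)
        map_smul' := fun c f => mul_left_cancel₀ (hne i hi) (by
          have h := hdem i hi (c • f)
          rw [map_smul] at h
          simp only [RingHom.id_apply, smul_eq_C_mul] at h ⊢
          linear_combination h - C c * hdem i hi f) }
    else 0
  have happ (i : ℕ) (hi : i + 1 < n) (f : MvPolynomial (Fin n) F) : A i f = dem i f - f := by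
    simp only [A, dif_pos hi]
    rfl
  have hA : IsDemazureBar A := fun i hi f => by
    rw [happ i hi, mul_sub, hdem i hi]
    ring
  obtain ⟨φ, hφ⟩ := hA.exists_equiv_regular hn
  exact ⟨φ, fun i hi f => by rw [← happ i hi, hφ i hi]⟩
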